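/- arXiv:1810.09114 — 3 statements merged into one kernel-verified Lean document; each statement's English description precedes it below -/
import Mathlib

section
/- Let n ≥ 1 and p ∈ ℕ₀. Then there exists a constant C > 0 such that for all t > 0: ( ∫_{|ξ|≤1} | E₀(t,ξ) − Σ_{k=0}^{p} e₀^k(t,ξ) |² dξ )^{1/2} ≤ C (1+t)^{−n/4−(p+1)/2}. -/
open MeasureTheory Filter

noncomputable section

/-- Euclidean space `ℝⁿ`. -/
abbrev Rn (n : ℕ) := EuclideanSpace ℝ (Fin n)

/-- Fourier transform `f̂(ξ) = ∫ e^{-i x·ξ} f(x) dx` of a real-valued `f`. -/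
def fourierHat (n : ℕ) (f : Rn n → ℝ) (ξ : Rn n) : ℂ :=
  ∫ x : Rn n, Complex.exp (-Complex.I * ((∑ i, x i * ξ i : ℝ) : ℂ)) * (f x : ℂ)

/-- Membership in the weighted space `L^{1,γ}(ℝⁿ)`. -/
def MemL1w (n : ℕ) (γ : ℝ) (f : Rn n → ℝ) : Prop :=
  MeasureTheory.Integrable f ∧
    MeasureTheory.Integrable (fun x : Rn n => (1 + ‖x‖) ^ γ * |f x|)

/-- The weighted norm `‖f‖_{1,γ}`. -/
def wnorm (n : ℕ) (γ : ℝ) (f : Rn n → ℝ) : ℝ :=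
  ∫ x : Rn n, (1 + ‖x‖) ^ γ * |f x|

/-- The evolution operator multiplier `E₀(t,ξ)`. -/
def E0 (n : ℕ) (t : ℝ) (ξ : Rn n) : ℝ :=
  if ‖ξ‖ ≤ 2 then
    Real.exp (-(t * ‖ξ‖ ^ 2) / 2) * Real.cos (t * ‖ξ‖ * Real.sqrt (4 - ‖ξ‖ ^ 2) / 2)
  else
    Real.exp (-(t * ‖ξ‖ ^ 2) / 2) * Real.cosh (t * ‖ξ‖ * Real.sqrt (‖ξ‖ ^ 2 - 4) / 2)

/-- The evolution operator multiplier `E₁(t,ξ)`. -/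
def E1 (n : ℕ) (t : ℝ) (ξ : Rn n) : ℝ :=
  if ‖ξ‖ ≤ 2 then
    Real.exp (-(t * ‖ξ‖ ^ 2) / 2) *
      (Real.sin (t * ‖ξ‖ * Real.sqrt (4 - ‖ξ‖ ^ 2) / 2) /
        (‖ξ‖ * Real.sqrt (4 - ‖ξ‖ ^ 2) / 2))
  else
    Real.exp (-(t * ‖ξ‖ ^ 2) / 2) *
      (Real.sinh (t * ‖ξ‖ * Real.sqrt (‖ξ‖ ^ 2 - 4) / 2) /
        (‖ξ‖ * Real.sqrt (‖ξ‖ ^ 2 - 4) / 2))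

/-- `L₀(a,t,ξ)` as a function of `a`. -/
def L0fun (n : ℕ) (t : ℝ) (ξ : Rn n) (a : ℝ) : ℝ :=
  Real.cos (t * ‖ξ‖ - t * ‖ξ‖ ^ 2 * (a / (4 + 2 * Real.sqrt (4 - a ^ 2))))

/-- `L₁(a,t,ξ)` as a function of `a`. -/
def L1fun (n : ℕ) (t : ℝ) (ξ : Rn n) (a : ℝ) : ℝ :=
  Real.sin (t * ‖ξ‖ - t * ‖ξ‖ ^ 2 * (a / (4 + 2 * Real.sqrt (4 - a ^ 2)))) /
    (‖ξ‖ * Real.sqrt (4 - a ^ 2) / 2)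

/-- `e₀^k(t,ξ) = e^{-t|ξ|²/2} (1/k!) (∂^k L₀/∂a^k)(0,t,ξ) |ξ|^k`. -/
def e0 (n : ℕ) (k : ℕ) (t : ℝ) (ξ : Rn n) : ℝ :=
  Real.exp (-(t * ‖ξ‖ ^ 2) / 2) * ((1 : ℝ) / k.factorial) *
    iteratedDeriv k (L0fun n t ξ) 0 * ‖ξ‖ ^ k

/-- `e₁^k(t,ξ) = e^{-t|ξ|²/2} (1/k!) (∂^k L₁/∂a^k)(0,t,ξ) |ξ|^k`. -/
def e1 (n : ℕ) (k : ℕ) (t : ℝ) (ξ : Rn n) : ℝ :=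
  Real.exp (-(t * ‖ξ‖ ^ 2) / 2) * ((1 : ℝ) / k.factorial) *
    iteratedDeriv k (L1fun n t ξ) 0 * ‖ξ‖ ^ k

/-- The moment polynomial
`m[f]^k(ξ) = ∑_{|α|=k} ((-1)^{|α|}/α!) (∫ x^α f(x) dx) (iξ)^α`. -/
def mom (n : ℕ) (f : Rn n → ℝ) (k : ℕ) (ξ : Rn n) : ℂ :=
  ∑ α ∈ Finset.univ.filter (fun α : Fin n → Fin (k + 1) => ∑ i, (α i).val = k),
    ((-1 : ℂ) ^ k / ∏ i, ((α i).val.factorial : ℂ)) *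
      ((∫ x : Rn n, (∏ i, x i ^ (α i).val) * f x : ℝ) : ℂ) *
      ∏ i, (Complex.I * (ξ i : ℂ)) ^ (α i).val

/-- The Fourier-space solution of the strongly damped wave equation. -/
def uhat (n : ℕ) (u₀ u₁ : Rn n → ℝ) (t : ℝ) (ξ : Rn n) : ℂ :=
  (E0 n t ξ : ℂ) * fourierHat n u₀ ξ +
    (E1 n t ξ : ℂ) * (((‖ξ‖ ^ 2 / 2 : ℝ) : ℂ) * fourierHat n u₀ ξ + fourierHat n u₁ ξ)

open Set in
/-- A `C^m` function on `[0,1]` has uniformly bounded derivatives up to order `m`. -/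
lemma exists_bound_iteratedDerivWithin {g : ℝ → ℝ} {m : ℕ} (hg : ContDiffOn ℝ m g (Icc 0 1)) :
    ∃ M : ℝ, 1 ≤ M ∧ ∀ i ≤ m, ∀ a ∈ Icc (0 : ℝ) 1,
      ‖iteratedDerivWithin i g (Icc 0 1) a‖ ≤ M := by
  have hbound : ∀ i : ℕ, ∃ B : ℝ, i ≤ m → ∀ a ∈ Icc (0 : ℝ) 1,
      ‖iteratedDerivWithin i g (Icc 0 1) a‖ ≤ B := by
    intro i
    by_cases hi : i ≤ m
    · obtain ⟨B, hB⟩ := isCompact_Icc.exists_bound_of_continuousOn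
        (hg.continuousOn_iteratedDerivWithin (m := i) (by exact_mod_cast hi)
          (uniqueDiffOn_Icc zero_lt_one))
      exact ⟨B, fun _ => hB⟩
    · exact ⟨0, fun h => absurd h hi⟩
  choose B hB using hbound
  refine ⟨1 + ∑ i ∈ Finset.range (m + 1), |B i|, ?_, fun i hi a ha => ?_⟩
  · have : 0 ≤ ∑ i ∈ Finset.range (m + 1), |B i| := Finset.sum_nonneg fun _ _ => abs_nonneg _
    linarith
  · have h1 : |B i| ≤ ∑ j ∈ Finset.range (m + 1), |B j| :=
      Finset.single_le_sum (f := fun j => |B j|) (fun _ _ => abs_nonneg _)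
        (Finset.mem_range.2 (by omega))
    linarith [hB i hi a ha, le_abs_self (B i)]

open Set in
/-- The derivatives of `cos (x - y g)` of order `m` grow at most like `(1 + y)^m`. -/
lemma exists_bound_iteratedDerivWithin_cos {g : ℝ → ℝ} {m : ℕ}
    (hg : ContDiffOn ℝ m g (Icc 0 1)) :
    ∃ K : ℝ, 0 < K ∧ ∀ x y : ℝ, 0 ≤ y → ∀ a ∈ Icc (0 : ℝ) 1,
      ‖iteratedDerivWithin m (fun a => Real.cos (x - y * g a)) (Icc 0 1) a‖ ≤ K * (1 + y) ^ m := by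
  obtain ⟨M, hM, hMb⟩ := exists_bound_iteratedDerivWithin hg
  refine ⟨m.factorial * M ^ m, by positivity, fun x y hy a ha => ?_⟩
  have hu : UniqueDiffOn ℝ (Icc (0 : ℝ) 1) := uniqueDiffOn_Icc zero_lt_one
  have hf : ContDiffOn ℝ m (fun a => x - y * g a) (Icc 0 1) :=
    contDiffOn_const.sub (contDiffOn_const.mul hg)
  have key := norm_iteratedFDerivWithin_comp_le (𝕜 := ℝ) (g := Real.cos)
    (f := fun a => x - y * g a) (n := m) (s := Icc 0 1) (t := univ) (x := a) (N := m)
    Real.contDiff_cos.contDiffOn hf le_rfl uniqueDiffOn_univ hu (mapsTo_univ _ _) ha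
    (C := 1) (D := M * (1 + y)) ?_ ?_
  · rw [norm_iteratedFDerivWithin_eq_norm_iteratedDerivWithin] at key
    calc _ ≤ _ := key
      _ = _ := by rw [mul_pow]; ring
  · intro i _
    rw [norm_iteratedFDerivWithin_eq_norm_iteratedDerivWithin, iteratedDerivWithin_univ]
    exact Real.abs_iteratedDeriv_cos_le_one _ _
  · intro i hi him
    rw [norm_iteratedFDerivWithin_eq_norm_iteratedDerivWithin]
    have hgi : ContDiffWithinAt ℝ i g (Icc 0 1) a := (hg a ha).of_le (by exact_mod_cast him)
    have hD : 1 ≤ M * (1 + y) := one_le_mul_of_one_le_of_one_le hM (by linarith)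
    have hval : iteratedDerivWithin i (fun a => x - y * g a) (Icc 0 1) a
        = -(y * iteratedDerivWithin i g (Icc 0 1) a) := by
      rw [iteratedDerivWithin_const_sub (by omega), iteratedDerivWithin_fun_neg,
        iteratedDerivWithin_const_mul ha hu _ hgi]
    rw [hval, norm_neg, norm_mul, Real.norm_of_nonneg hy]
    calc y * ‖iteratedDerivWithin i g (Icc 0 1) a‖ ≤ (1 + y) * M := by
          gcongr
          · linarith
          · exact hMb i him a ha
      _ = M * (1 + y) := mul_comm _ _
      _ ≤ _ := le_self_pow₀ hD (by omega)

lemma contDiffAt_phase {a : ℝ} (ha : |a| < 2) (m : WithTop ℕ∞) :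
    ContDiffAt ℝ m (fun a : ℝ => a / (4 + 2 * Real.sqrt (4 - a ^ 2))) a := by
  have h4 : 4 - a ^ 2 ≠ 0 := by
    have := sq_lt_sq' (by linarith [abs_lt.1 ha] : -2 < a) (abs_lt.1 ha).2
    nlinarith
  refine contDiffAt_id.div (contDiffAt_const.add (contDiffAt_const.mul
    ((contDiffAt_const.sub (contDiffAt_id.pow 2)).sqrt h4))) ?_
  positivity

/-- On `|ξ| ≤ 2`, `E₀(t,ξ) = e^{-t|ξ|²/2} L₀(|ξ|,t,ξ)`. -/
lemma E0_eq_L0fun (n : ℕ) (t : ℝ) {ξ : Rn n} (hξ : ‖ξ‖ ≤ 2) :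
    E0 n t ξ = Real.exp (-(t * ‖ξ‖ ^ 2) / 2) * L0fun n t ξ ‖ξ‖ := by
  rw [E0, if_pos hξ, L0fun]
  congr 2
  have h0 : 0 ≤ 4 - ‖ξ‖ ^ 2 := by nlinarith [norm_nonneg ξ]
  have hs := Real.sq_sqrt h0
  have hs0 := Real.sqrt_nonneg (4 - ‖ξ‖ ^ 2)
  set s := Real.sqrt (4 - ‖ξ‖ ^ 2)
  have hd : 4 + 2 * s ≠ 0 := by positivity
  field_simp
  linear_combination (2 * t * ‖ξ‖) * hs

open Set in
/-- Pointwise Taylor remainder estimate for the low-frequency expansion of `E₀`. -/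
lemma exists_abs_E0_sub_sum_e0_le (n p : ℕ) :
    ∃ K : ℝ, 0 < K ∧ ∀ t : ℝ, 0 ≤ t → ∀ ξ : Rn n, ‖ξ‖ ≤ 1 →
      |E0 n t ξ - ∑ k ∈ Finset.range (p + 1), e0 n k t ξ| ≤
        K * Real.exp (-(t * ‖ξ‖ ^ 2) / 2) * (1 + t * ‖ξ‖ ^ 2) ^ (p + 1) * ‖ξ‖ ^ (p + 1) := by
  have habs : ∀ a ∈ Icc (0 : ℝ) 1, |a| < 2 := fun a ha =>
    abs_lt.2 ⟨by linarith [ha.1], by linarith [ha.2]⟩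
  have hu : UniqueDiffOn ℝ (Icc (0 : ℝ) 1) := uniqueDiffOn_Icc zero_lt_one
  obtain ⟨K, hK, hKb⟩ := exists_bound_iteratedDerivWithin_cos (m := p + 1)
    (g := fun a : ℝ => a / (4 + 2 * Real.sqrt (4 - a ^ 2)))
    (fun a ha => (contDiffAt_phase (habs a ha) _).contDiffWithinAt)
  refine ⟨K / p.factorial, by positivity, fun t ht ξ hξ => ?_⟩
  have hsmooth : ∀ a ∈ Icc (0 : ℝ) 1, ∀ m : ℕ, ContDiffAt ℝ m (L0fun n t ξ) a := fun a ha m =>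
    (contDiffAt_const.sub (contDiffAt_const.mul (contDiffAt_phase (habs a ha) m))).cos
  have htaylor := taylor_mean_remainder_bound (f := L0fun n t ξ) (n := p) zero_le_one
    (fun a ha => (hsmooth a ha (p + 1)).contDiffWithinAt)
    (⟨norm_nonneg ξ, hξ⟩ : ‖ξ‖ ∈ Icc (0 : ℝ) 1)
    (fun a ha => hKb (t * ‖ξ‖) (t * ‖ξ‖ ^ 2) (by positivity) a ha)
  rw [taylor_within_apply, sub_zero] at htaylor
  have hsum : ∑ k ∈ Finset.range (p + 1), e0 n k t ξ = Real.exp (-(t * ‖ξ‖ ^ 2) / 2) *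
      ∑ k ∈ Finset.range (p + 1), ((k.factorial : ℝ)⁻¹ * ‖ξ‖ ^ k) •
        iteratedDerivWithin k (L0fun n t ξ) (Icc 0 1) 0 := by
    rw [Finset.mul_sum]
    refine Finset.sum_congr rfl fun k _ => ?_
    have h0 : (0 : ℝ) ∈ Icc (0 : ℝ) 1 := ⟨le_rfl, zero_le_one⟩
    rw [iteratedDerivWithin_eq_iteratedDeriv hu (hsmooth 0 h0 k) h0, e0, smul_eq_mul]
    ring
  rw [E0_eq_L0fun n t (by linarith), hsum, ← mul_sub, abs_mul, abs_of_pos (Real.exp_pos _)]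
  calc _ ≤ _ := mul_le_mul_of_nonneg_left htaylor (Real.exp_pos _).le
    _ = _ := by ring

/-- The Gaussian factor absorbs the polynomial growth, leaving decay `(1 + t)^(-m)`. -/
lemma sq_gaussian_poly_le {m : ℕ} {K t r : ℝ} (hr : 0 ≤ r) (hr1 : r ≤ 1) (ht : 0 ≤ t) :
    (K * Real.exp (-(t * r ^ 2) / 2) * (1 + t * r ^ 2) ^ m * r ^ m) ^ 2 ≤
      K ^ 2 * (Real.exp 1 * (2 ^ (3 * m) * (3 * m).factorial * Real.exp (1 / 2))) /
        (1 + t) ^ m * Real.exp (-((1 + t) / 2) * r ^ 2) := by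
  set s := 1 + t with hs
  have hs0 : 0 < s := by linarith
  set w := s * r ^ 2 with hw
  have hw0 : 0 ≤ w := by positivity
  have hr2 : r ^ 2 ≤ 1 := pow_le_one₀ hr hr1
  have hexp : Real.exp (-(t * r ^ 2) / 2) ^ 2 ≤ Real.exp 1 * Real.exp (-w) := by
    rw [← Real.exp_nat_mul, ← Real.exp_add]
    apply Real.exp_le_exp.2
    simp only [hw, hs]
    push_cast
    nlinarith
  have hle : 1 + t * r ^ 2 ≤ 1 + w := by simp only [hw, hs]; nlinarith
  have hpow : (1 + w) ^ (3 * m) ≤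
      2 ^ (3 * m) * (3 * m).factorial * Real.exp (1 / 2) * Real.exp (w / 2) := by
    have h := Real.pow_div_factorial_le_exp ((1 + w) / 2) (by positivity) (3 * m)
    rw [div_le_iff₀ (by positivity), div_pow, div_le_iff₀ (by positivity)] at h
    calc _ ≤ _ := h
      _ = _ := by rw [add_div, Real.exp_add]; ring
  have hrw : (r ^ m) ^ 2 = w ^ m / s ^ m := by
    rw [hw, mul_pow]; field_simp; ring
  calc (K * Real.exp (-(t * r ^ 2) / 2) * (1 + t * r ^ 2) ^ m * r ^ m) ^ 2
      = K ^ 2 * Real.exp (-(t * r ^ 2) / 2) ^ 2 * ((1 + t * r ^ 2) ^ m) ^ 2 * (w ^ m / s ^ m) := by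
        rw [← hrw]; ring
    _ ≤ K ^ 2 * (Real.exp 1 * Real.exp (-w)) * ((1 + w) ^ m) ^ 2 * ((1 + w) ^ m / s ^ m) := by
        gcongr
        linarith
    _ = K ^ 2 * (Real.exp 1 * Real.exp (-w)) / s ^ m * (1 + w) ^ (3 * m) := by ring
    _ ≤ K ^ 2 * (Real.exp 1 * Real.exp (-w)) / s ^ m *
        (2 ^ (3 * m) * (3 * m).factorial * Real.exp (1 / 2) * Real.exp (w / 2)) := by gcongr
    _ = K ^ 2 * (Real.exp 1 * (2 ^ (3 * m) * (3 * m).factorial * Real.exp (1 / 2))) / s ^ m *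
        (Real.exp (-w) * Real.exp (w / 2)) := by ring
    _ = _ := by
        rw [← Real.exp_add]
        congr 2
        rw [hw]; ring

theorem stmt10 (n : ℕ) (hn : 1 ≤ n) (p : ℕ) :
    ∃ C : ℝ, 0 < C ∧ ∀ t : ℝ, 0 < t →
      Real.sqrt (∫ ξ in Metric.closedBall (0 : Rn n) 1,
          |E0 n t ξ - ∑ k ∈ Finset.range (p + 1), e0 n k t ξ| ^ 2) ≤
        C * (1 + t) ^ (-(n : ℝ) / 4 - ((p : ℝ) + 1) / 2) := by
  obtain ⟨K, hK, hKb⟩ := exists_abs_E0_sub_sum_e0_le n p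
  set A : ℝ := K ^ 2 * (Real.exp 1 * (2 ^ (3 * (p + 1)) * (3 * (p + 1)).factorial *
    Real.exp (1 / 2))) with hA
  have hApos : 0 < A := by positivity
  refine ⟨Real.sqrt (A * (2 * Real.pi) ^ ((n : ℝ) / 2)), by positivity, fun t ht => ?_⟩
  have hs : 0 < 1 + t := by linarith
  have hgauss := GaussianFourier.integral_rexp_neg_mul_sq_norm (V := Rn n) (half_pos hs)
  rw [finrank_euclideanSpace_fin] at hgauss
  have hint : Integrable (fun ξ : Rn n => Real.exp (-((1 + t) / 2) * ‖ξ‖ ^ 2)) :=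
    Integrable.of_integral_ne_zero (by rw [hgauss]; positivity)
  have hbound : ∫ ξ in Metric.closedBall (0 : Rn n) 1,
      |E0 n t ξ - ∑ k ∈ Finset.range (p + 1), e0 n k t ξ| ^ 2 ≤
        A / (1 + t) ^ (p + 1) * (Real.pi / ((1 + t) / 2)) ^ ((n : ℝ) / 2) := by
    calc _ ≤ ∫ ξ in Metric.closedBall (0 : Rn n) 1,
          A / (1 + t) ^ (p + 1) * Real.exp (-((1 + t) / 2) * ‖ξ‖ ^ 2) := by
          refine integral_mono_of_nonneg (Eventually.of_forall fun ξ => by positivity)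
            (hint.const_mul _).integrableOn ?_
          filter_upwards [ae_restrict_mem Metric.isClosed_closedBall.measurableSet] with ξ hξ
          rw [mem_closedBall_zero_iff] at hξ
          exact (pow_le_pow_left₀ (abs_nonneg _) (hKb t ht.le ξ hξ) 2).trans
            (sq_gaussian_poly_le (norm_nonneg ξ) hξ ht.le)
      _ ≤ ∫ ξ : Rn n, A / (1 + t) ^ (p + 1) * Real.exp (-((1 + t) / 2) * ‖ξ‖ ^ 2) :=
          setIntegral_le_integral (hint.const_mul _)
            (Eventually.of_forall fun ξ => by positivity)
      _ = _ := by rw [integral_const_mul, hgauss]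
  calc _ ≤ Real.sqrt (A / (1 + t) ^ (p + 1) * (Real.pi / ((1 + t) / 2)) ^ ((n : ℝ) / 2)) :=
        Real.sqrt_le_sqrt hbound
    _ = Real.sqrt (A * (2 * Real.pi) ^ ((n : ℝ) / 2) *
          ((1 + t) ^ (-(n : ℝ) / 4 - ((p : ℝ) + 1) / 2)) ^ 2) := by
        congr 1
        rw [← Real.rpow_natCast (_ ^ _) 2, ← Real.rpow_mul hs.le,
          show Real.pi / ((1 + t) / 2) = (2 * Real.pi) / (1 + t) by field_simp,
          Real.div_rpow (by positivity) hs.le, ← Real.rpow_natCast (1 + t) (p + 1),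
          show (-(n : ℝ) / 4 - ((p : ℝ) + 1) / 2) * ((2 : ℕ) : ℝ)
            = -(((p + 1 : ℕ) : ℝ) + (n : ℝ) / 2) by push_cast; ring,
          Real.rpow_neg hs.le, Real.rpow_add hs]
        field_simp
    _ = _ := by
        rw [Real.sqrt_mul (by positivity), Real.sqrt_sq (by positivity)]
end
end

section
/- Let n ≥ 1, γ ≥ 0, c > 0 and f ∈ L^{1,γ}(ℝⁿ). Then lim_{t→∞} t^{n/4+γ/2} · ( ∫_{ℝⁿ} | e^{−c t |ξ|²} f̂(ξ) − Σ_{k=0}^{⌊γ⌋} m[f]^k(ξ) e^{−c t |ξ|²} |² dξ )^{1/2} = 0. -/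
open MeasureTheory Filter

noncomputable section

/-- The remainder of the Taylor polynomial of degree `N` of `z ↦ e^{-iz}`. -/
def expRemainder (N : ℕ) (z : ℝ) : ℂ :=
  Complex.exp (-Complex.I * z) - ∑ k ∈ Finset.range (N + 1), (-Complex.I * z) ^ k / k.factorial

lemma continuous_expRemainder (N : ℕ) : Continuous (expRemainder N) := by
  unfold expRemainder
  fun_prop

lemma norm_exp_neg_I_mul_ofReal (z : ℝ) : ‖Complex.exp (-Complex.I * z)‖ = 1 := by
  rw [show -Complex.I * (z : ℂ) = ((-z : ℝ) : ℂ) * Complex.I by push_cast; ring]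
  exact Complex.norm_exp_ofReal_mul_I _

lemma norm_expRemainder_le_pow {N : ℕ} {z : ℝ} (hz : |z| ≤ 1) :
    ‖expRemainder N z‖ ≤ (N + 2) * |z| ^ (N + 1) := by
  have hn : ‖-Complex.I * (z : ℂ)‖ = |z| := by simp
  have h := Complex.exp_bound (hn.trans_le hz) N.succ_pos
  rw [hn] at h
  refine h.trans ?_
  rw [mul_comm]
  gcongr
  have h1 : (1 : ℝ) ≤ ((N + 1).factorial * (N + 1 : ℕ) : ℝ) := by
    exact_mod_cast Nat.mul_pos (Nat.factorial_pos _) N.succ_pos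
  calc ((N + 1).succ : ℝ) * ((N + 1).factorial * (N + 1 : ℕ) : ℝ)⁻¹
      ≤ (N + 1).succ * 1 := by gcongr; exact inv_le_one_of_one_le₀ h1
    _ = N + 2 := by push_cast; ring

lemma norm_expRemainder_le_rpow {γ : ℝ} (hγ : 0 ≤ γ) (z : ℝ) :
    ‖expRemainder ⌊γ⌋₊ z‖ ≤ (⌊γ⌋₊ + 2) * |z| ^ γ := by
  have hle : (⌊γ⌋₊ : ℝ) ≤ γ := Nat.floor_le hγ
  have hlt : γ < ⌊γ⌋₊ + 1 := Nat.lt_floor_add_one γ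
  set N := ⌊γ⌋₊
  rcases le_total |z| 1 with hz | hz
  · refine (norm_expRemainder_le_pow hz).trans ?_
    gcongr
    rw [← Real.rpow_natCast]
    exact Real.rpow_le_rpow_of_exponent_ge_of_imp (abs_nonneg z) hz (by push_cast; linarith)
      (fun _ h0 => absurd h0 (by positivity))
  · have hpow : ∀ k ∈ Finset.range (N + 1), |z| ^ k ≤ |z| ^ γ := fun k hk => by
      rw [← Real.rpow_natCast]
      refine Real.rpow_le_rpow_of_exponent_le hz (le_trans ?_ hle)
      exact_mod_cast Finset.mem_range_succ_iff.mp hk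
    have hone : (1 : ℝ) ≤ |z| ^ γ := Real.one_le_rpow hz hγ
    calc ‖expRemainder N z‖
        ≤ ‖Complex.exp (-Complex.I * z)‖ +
          ∑ k ∈ Finset.range (N + 1), ‖(-Complex.I * (z : ℂ)) ^ k / k.factorial‖ :=
          (norm_sub_le _ _).trans (by gcongr; exact norm_sum_le _ _)
      _ ≤ |z| ^ γ + ∑ k ∈ Finset.range (N + 1), |z| ^ γ := by
          rw [norm_exp_neg_I_mul_ofReal]
          gcongr with k hk
          refine le_trans ?_ (hpow k hk)
          simp only [norm_div, norm_pow, norm_mul, norm_neg, Complex.norm_I, one_mul,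
            Complex.norm_real, Real.norm_eq_abs, Complex.norm_natCast]
          exact div_le_self (by positivity) (by exact_mod_cast k.factorial_pos)
      _ = (N + 2) * |z| ^ γ := by
          rw [Finset.sum_const, Finset.card_range, nsmul_eq_mul]; push_cast; ring

lemma tendsto_rpow_mul_expRemainder {γ : ℝ} (a : ℝ) :
    Tendsto (fun r : ℝ => ((r ^ γ : ℝ) : ℂ) * expRemainder ⌊γ⌋₊ (r⁻¹ * a)) atTop (nhds 0) := by
  have hlt : γ < ⌊γ⌋₊ + 1 := Nat.lt_floor_add_one γ
  set N := ⌊γ⌋₊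
  have hlim : Tendsto (fun r : ℝ => (N + 2) * |a| ^ (N + 1) * r ^ (-(N + 1 - γ)))
      atTop (nhds 0) := by
    simpa using (tendsto_rpow_neg_atTop (by linarith : 0 < N + 1 - γ)).const_mul
      ((N + 2) * |a| ^ (N + 1))
  refine squeeze_zero_norm' ?_ hlim
  filter_upwards [eventually_ge_atTop |a|, eventually_gt_atTop 0] with r hr hr0
  have habs : |r⁻¹ * a| = r⁻¹ * |a| := by rw [abs_mul, abs_of_pos (inv_pos.mpr hr0)]
  have hz : |r⁻¹ * a| ≤ 1 := by
    rw [habs, inv_mul_le_iff₀ hr0]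
    simpa using hr
  rw [norm_mul, Complex.norm_real, Real.norm_of_nonneg (by positivity)]
  calc r ^ γ * ‖expRemainder N (r⁻¹ * a)‖
      ≤ r ^ γ * ((N + 2) * |r⁻¹ * a| ^ (N + 1)) := by
        gcongr; exact norm_expRemainder_le_pow hz
    _ = (N + 2) * |a| ^ (N + 1) * (r ^ γ * r⁻¹ ^ (N + 1)) := by rw [habs]; ring
    _ = (N + 2) * |a| ^ (N + 1) * r ^ (-(N + 1 - γ)) := by
        rw [inv_pow, ← Real.rpow_natCast r, ← Real.rpow_neg hr0.le, ← Real.rpow_add hr0]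
        congr 2
        push_cast
        ring

lemma sum_pow_div_factorial_eq_sum_multiindex {n : ℕ} (k : ℕ) (y : Fin n → ℂ) :
    (∑ i, y i) ^ k / k.factorial =
      ∑ α ∈ Finset.univ.filter (fun α : Fin n → Fin (k + 1) => ∑ i, (α i).val = k),
        ∏ i, y i ^ (α i).val / ((α i).val.factorial : ℂ) := by
  rw [Finset.sum_pow_eq_sum_piAntidiag, Finset.sum_div]
  symm
  refine Finset.sum_bij (fun α _ i => (α i).val) ?_ ?_ ?_ ?_
  · intro α hα
    simpa using hα
  · intro α _ β _ h
    funext i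
    exact Fin.ext (congrFun h i)
  · intro β hβ
    have hβ' : ∑ i, β i = k := by simpa using hβ
    refine ⟨fun i => ⟨β i, Nat.lt_succ_of_le (hβ' ▸ Finset.single_le_sum
      (fun _ _ => Nat.zero_le _) (Finset.mem_univ i))⟩, by simpa using hβ', rfl⟩
  · intro α hα
    have hα' : ∑ i, (α i).val = k := by simpa using hα
    have hm : (∏ i, ((α i).val.factorial : ℂ)) *
        Nat.multinomial Finset.univ (fun i => (α i).val) = k.factorial := by
      have h := Nat.multinomial_spec Finset.univ (fun i => (α i).val)
      rw [hα'] at h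
      exact_mod_cast h
    have hp : (∏ i, ((α i).val.factorial : ℂ)) ≠ 0 :=
      Finset.prod_ne_zero_iff.mpr fun i _ => by exact_mod_cast (α i).val.factorial_ne_zero
    have hk : (k.factorial : ℂ) ≠ 0 := by exact_mod_cast k.factorial_ne_zero
    rw [Finset.prod_div_distrib, div_eq_div_iff hp hk, ← hm]
    ring

lemma abs_sum_mul_le_norm_mul_norm {n : ℕ} (x ξ : Rn n) : |∑ i, x i * ξ i| ≤ ‖x‖ * ‖ξ‖ := by
  have h := abs_real_inner_le_norm ξ x
  rw [PiLp.inner_apply, mul_comm] at h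
  simpa using h

lemma abs_prod_pow_le_norm_pow {n : ℕ} (x : Rn n) (α : Fin n → ℕ) :
    |∏ i, x i ^ α i| ≤ ‖x‖ ^ ∑ i, α i := by
  rw [Finset.abs_prod, ← Finset.prod_pow_eq_pow_sum]
  refine Finset.prod_le_prod (fun _ _ => abs_nonneg _) fun i _ => ?_
  rw [abs_pow]
  gcongr
  exact PiLp.norm_apply_le x i

lemma MemL1w.integrable_rpow_mul {n : ℕ} {γ s : ℝ} {f : Rn n → ℝ} (hf : MemL1w n γ f)
    (hs : 0 ≤ s) (hsγ : s ≤ γ) : Integrable (fun x : Rn n => ‖x‖ ^ s * |f x|) := by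
  refine hf.2.mono' ?_ (.of_forall fun x => ?_)
  · have : Measurable fun x : Rn n => ‖x‖ ^ s := by fun_prop
    exact this.aestronglyMeasurable.mul hf.1.abs.aestronglyMeasurable
  · rw [Real.norm_of_nonneg (by positivity)]
    gcongr
    calc ‖x‖ ^ s ≤ (1 + ‖x‖) ^ s := by gcongr; linarith
      _ ≤ (1 + ‖x‖) ^ γ := Real.rpow_le_rpow_of_exponent_le (by linarith [norm_nonneg x]) hsγ

lemma MemL1w.integrable_prod_pow_mul {n : ℕ} {γ : ℝ} {f : Rn n → ℝ} (hf : MemL1w n γ f)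
    (α : Fin n → ℕ) (hα : ((∑ i, α i : ℕ) : ℝ) ≤ γ) :
    Integrable (fun x : Rn n => (∏ i, x i ^ α i) * f x) := by
  refine (hf.integrable_rpow_mul (Nat.cast_nonneg _) hα).mono' ?_ (.of_forall fun x => ?_)
  · have : Continuous fun x : Rn n => ∏ i, x i ^ α i := by fun_prop
    exact this.aestronglyMeasurable.mul hf.1.aestronglyMeasurable
  · rw [norm_mul, Real.norm_eq_abs, Real.norm_eq_abs, Real.rpow_natCast]
    gcongr
    exact abs_prod_pow_le_norm_pow x α

lemma MemL1w.integrable_pow_mul {n : ℕ} {γ : ℝ} {f : Rn n → ℝ} (hf : MemL1w n γ f)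
    {k : ℕ} (hk : (k : ℝ) ≤ γ) (ξ : Rn n) :
    Integrable (fun x : Rn n =>
      (-Complex.I * ((∑ i, x i * ξ i : ℝ) : ℂ)) ^ k / k.factorial * (f x : ℂ)) := by
  refine ((hf.integrable_rpow_mul (Nat.cast_nonneg k) hk).const_mul (‖ξ‖ ^ k)).mono' ?_
    (.of_forall fun x => ?_)
  · have : Continuous fun x : Rn n =>
        (-Complex.I * ((∑ i, x i * ξ i : ℝ) : ℂ)) ^ k / k.factorial := by fun_prop
    exact this.aestronglyMeasurable.mul hf.1.ofReal.aestronglyMeasurable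
  · simp only [norm_div, norm_pow, norm_mul, norm_neg, Complex.norm_I, one_mul,
      Complex.norm_real, Real.norm_eq_abs, Complex.norm_natCast, Real.rpow_natCast]
    rw [← mul_assoc, ← mul_pow]
    gcongr
    refine (div_le_self (by positivity) (by exact_mod_cast k.factorial_pos)).trans ?_
    gcongr
    exact (abs_sum_mul_le_norm_mul_norm x ξ).trans_eq (mul_comm _ _)

lemma mom_eq_integral {n : ℕ} {γ : ℝ} {f : Rn n → ℝ} (hf : MemL1w n γ f)
    {k : ℕ} (hk : (k : ℝ) ≤ γ) (ξ : Rn n) :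
    mom n f k ξ = ∫ x : Rn n,
      (-Complex.I * ((∑ i, x i * ξ i : ℝ) : ℂ)) ^ k / k.factorial * (f x : ℂ) := by
  have hpt : ∀ x : Rn n,
      (-Complex.I * ((∑ i, x i * ξ i : ℝ) : ℂ)) ^ k / k.factorial * (f x : ℂ) =
      ∑ α ∈ Finset.univ.filter (fun α : Fin n → Fin (k + 1) => ∑ i, (α i).val = k),
        ((-1 : ℂ) ^ k / ∏ i, ((α i).val.factorial : ℂ)) *
          (((∏ i, x i ^ (α i).val) * f x : ℝ) : ℂ) *
          ∏ i, (Complex.I * (ξ i : ℂ)) ^ (α i).val := fun x => by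
    have hs : -Complex.I * ((∑ i, x i * ξ i : ℝ) : ℂ) =
        ∑ i, -1 * (x i : ℂ) * (Complex.I * ξ i) := by
      push_cast
      rw [Finset.mul_sum]
      exact Finset.sum_congr rfl fun i _ => by ring
    rw [hs, sum_pow_div_factorial_eq_sum_multiindex, Finset.sum_mul]
    refine Finset.sum_congr rfl fun α hα => ?_
    have hα' : ∑ i, (α i).val = k := by simpa using hα
    simp only [mul_pow, Finset.prod_div_distrib, Finset.prod_mul_distrib]
    rw [Finset.prod_pow_eq_pow_sum, hα']
    push_cast
    ring
  simp_rw [hpt]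
  rw [integral_finsetSum]
  · refine Finset.sum_congr rfl fun α _ => ?_
    rw [integral_mul_const, integral_const_mul, ← integral_complex_ofReal]
  · intro α hα
    have hα' : ∑ i, (α i).val = k := by simpa using hα
    exact (((hf.integrable_prod_pow_mul _ (by rwa [hα'])).ofReal (𝕜 := ℂ)).const_mul _).mul_const _

lemma continuous_fourierHat {n : ℕ} {f : Rn n → ℝ} (hf : Integrable f) :
    Continuous (fourierHat n f) := by
  refine continuous_of_dominated (bound := fun x => |f x|) (fun ξ => ?_)
    (fun ξ => .of_forall fun x => ?_) hf.abs (.of_forall fun x => by fun_prop)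
  · have : Continuous fun x : Rn n => Complex.exp (-Complex.I * ((∑ i, x i * ξ i : ℝ) : ℂ)) := by
      fun_prop
    exact this.aestronglyMeasurable.mul hf.ofReal.aestronglyMeasurable
  · rw [norm_mul, norm_exp_neg_I_mul_ofReal]
    simp

lemma continuous_mom (n : ℕ) (f : Rn n → ℝ) (k : ℕ) : Continuous (mom n f k) := by
  unfold mom
  fun_prop

/-- The error in approximating `f̂` by its moment expansion of degree `N`. -/
def momentRemainder (n : ℕ) (f : Rn n → ℝ) (N : ℕ) (ξ : Rn n) : ℂ :=
  fourierHat n f ξ - ∑ k ∈ Finset.range (N + 1), mom n f k ξ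

lemma continuous_momentRemainder {n : ℕ} {f : Rn n → ℝ} (hf : Integrable f) (N : ℕ) :
    Continuous (momentRemainder n f N) :=
  (continuous_fourierHat hf).sub (continuous_finsetSum _ fun k _ => continuous_mom n f k)

lemma momentRemainder_eq_integral {n : ℕ} {γ : ℝ} (hγ : 0 ≤ γ) {f : Rn n → ℝ}
    (hf : MemL1w n γ f) (ξ : Rn n) :
    momentRemainder n f ⌊γ⌋₊ ξ =
      ∫ x : Rn n, expRemainder ⌊γ⌋₊ (∑ i, x i * ξ i) * (f x : ℂ) := by
  have hk : ∀ k ∈ Finset.range (⌊γ⌋₊ + 1), (k : ℝ) ≤ γ := fun k hk =>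
    (Nat.cast_le.mpr (Finset.mem_range_succ_iff.mp hk)).trans (Nat.floor_le hγ)
  have hexp : Integrable fun x : Rn n =>
      Complex.exp (-Complex.I * ((∑ i, x i * ξ i : ℝ) : ℂ)) * (f x : ℂ) := by
    refine hf.1.ofReal.bdd_mul (c := 1) ?_ (.of_forall fun x => (norm_exp_neg_I_mul_ofReal _).le)
    have : Continuous fun x : Rn n => Complex.exp (-Complex.I * ((∑ i, x i * ξ i : ℝ) : ℂ)) := by
      fun_prop
    exact this.aestronglyMeasurable
  unfold momentRemainder fourierHat
  rw [Finset.sum_congr rfl fun k h => mom_eq_integral hf (hk k h) ξ,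
    ← integral_finsetSum _ fun k h => hf.integrable_pow_mul (hk k h) ξ,
    ← integral_sub hexp (integrable_finsetSum _ fun k h => hf.integrable_pow_mul (hk k h) ξ)]
  simp only [expRemainder, sub_mul, Finset.sum_mul]

lemma norm_expRemainder_mul_le {n : ℕ} {γ : ℝ} (hγ : 0 ≤ γ) (f : Rn n → ℝ) (x ξ : Rn n) :
    ‖expRemainder ⌊γ⌋₊ (∑ i, x i * ξ i) * (f x : ℂ)‖ ≤
      (⌊γ⌋₊ + 2) * ‖ξ‖ ^ γ * (‖x‖ ^ γ * |f x|) := by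
  rw [norm_mul, Complex.norm_real, Real.norm_eq_abs, ← mul_assoc]
  gcongr
  calc ‖expRemainder ⌊γ⌋₊ (∑ i, x i * ξ i)‖ ≤ (⌊γ⌋₊ + 2) * |∑ i, x i * ξ i| ^ γ :=
        norm_expRemainder_le_rpow hγ _
    _ ≤ (⌊γ⌋₊ + 2) * (‖x‖ * ‖ξ‖) ^ γ := by
        gcongr
        exact abs_sum_mul_le_norm_mul_norm x ξ
    _ = (⌊γ⌋₊ + 2) * ‖ξ‖ ^ γ * ‖x‖ ^ γ := by
        rw [Real.mul_rpow (norm_nonneg _) (norm_nonneg _)]; ring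

lemma exists_norm_momentRemainder_le {n : ℕ} {γ : ℝ} (hγ : 0 ≤ γ) {f : Rn n → ℝ}
    (hf : MemL1w n γ f) : ∃ K, 0 ≤ K ∧ ∀ ξ, ‖momentRemainder n f ⌊γ⌋₊ ξ‖ ≤ K * ‖ξ‖ ^ γ := by
  refine ⟨(⌊γ⌋₊ + 2) * ∫ x : Rn n, ‖x‖ ^ γ * |f x|,
    mul_nonneg (by positivity) (integral_nonneg fun x => by positivity), fun ξ => ?_⟩
  rw [momentRemainder_eq_integral hγ hf]
  refine (norm_integral_le_of_norm_le ((hf.integrable_rpow_mul hγ le_rfl).const_mul _)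
    (.of_forall (norm_expRemainder_mul_le hγ f · ξ))).trans_eq ?_
  rw [integral_const_mul]
  ring

lemma norm_inv_smul_rpow {n : ℕ} {γ r : ℝ} (hr : 0 < r) (ξ : Rn n) :
    r ^ γ * ‖r⁻¹ • ξ‖ ^ γ = ‖ξ‖ ^ γ := by
  rw [← Real.mul_rpow hr.le (norm_nonneg _), norm_smul, Real.norm_of_nonneg (by positivity),
    mul_inv_cancel_left₀ hr.ne']

lemma tendsto_rpow_mul_momentRemainder {n : ℕ} {γ : ℝ} (hγ : 0 ≤ γ) {f : Rn n → ℝ}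
    (hf : MemL1w n γ f) (ξ : Rn n) :
    Tendsto (fun r : ℝ => ((r ^ γ : ℝ) : ℂ) * momentRemainder n f ⌊γ⌋₊ (r⁻¹ • ξ))
      atTop (nhds 0) := by
  simp_rw [momentRemainder_eq_integral hγ hf, ← integral_const_mul]
  rw [← integral_zero (Rn n) ℂ]
  refine tendsto_integral_filter_of_dominated_convergence
    (fun x => (⌊γ⌋₊ + 2) * ‖ξ‖ ^ γ * (‖x‖ ^ γ * |f x|)) (.of_forall fun r => ?_) ?_
    ((hf.integrable_rpow_mul hγ le_rfl).const_mul _) (.of_forall fun x => ?_)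
  · have : Continuous fun x : Rn n => expRemainder ⌊γ⌋₊ (∑ i, x i * (r⁻¹ • ξ) i) :=
      (continuous_expRemainder _).comp (by fun_prop)
    exact (this.aestronglyMeasurable.mul hf.1.ofReal.aestronglyMeasurable).const_mul _
  · filter_upwards [eventually_gt_atTop 0] with r hr
    refine .of_forall fun x => ?_
    rw [norm_mul, Complex.norm_real, Real.norm_of_nonneg (by positivity)]
    calc _ ≤ r ^ γ * ((⌊γ⌋₊ + 2) * ‖r⁻¹ • ξ‖ ^ γ * (‖x‖ ^ γ * |f x|)) := by
          gcongr
          exact norm_expRemainder_mul_le hγ f x _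
      _ = (⌊γ⌋₊ + 2) * (r ^ γ * ‖r⁻¹ • ξ‖ ^ γ) * (‖x‖ ^ γ * |f x|) := by ring
      _ = _ := by rw [norm_inv_smul_rpow hr]
  · have h := (tendsto_rpow_mul_expRemainder (γ := γ) (∑ i, x i * ξ i)).mul_const (f x : ℂ)
    rw [zero_mul] at h
    refine h.congr fun r => ?_
    rw [mul_assoc, Finset.mul_sum]
    congr 4
    funext i
    simp only [PiLp.smul_apply, smul_eq_mul]
    ring

lemma integrable_norm_rpow_mul_exp_neg_mul_sq {n : ℕ} (hn : 1 ≤ n) {s b : ℝ} (hs : 0 ≤ s)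
    (hb : 0 < b) : Integrable (fun ξ : Rn n => ‖ξ‖ ^ s * Real.exp (-b * ‖ξ‖ ^ 2)) := by
  have : Nonempty (Fin n) := ⟨⟨0, hn⟩⟩
  rw [integrable_fun_norm_addHaar volume (f := fun y => y ^ s * Real.exp (-b * y ^ 2))]
  refine (integrableOn_rpow_mul_exp_neg_mul_sq hb
    (s := (Module.finrank ℝ (Rn n) - 1 : ℕ) + s) (by
      have := Nat.cast_nonneg (α := ℝ) (Module.finrank ℝ (Rn n) - 1)
      linarith)).congr_fun (fun y hy => ?_) measurableSet_Ioi
  simp only [smul_eq_mul]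
  rw [Real.rpow_add hy, Real.rpow_natCast, mul_assoc]

lemma tendsto_integral_exp_mul_momentRemainder {n : ℕ} (hn : 1 ≤ n) {γ : ℝ} (hγ : 0 ≤ γ)
    {c : ℝ} (hc : 0 < c) {f : Rn n → ℝ} (hf : MemL1w n γ f) :
    Tendsto (fun r : ℝ => ∫ ξ : Rn n, Real.exp (-(2 * c) * ‖ξ‖ ^ 2) *
      ‖((r ^ γ : ℝ) : ℂ) * momentRemainder n f ⌊γ⌋₊ (r⁻¹ • ξ)‖ ^ 2) atTop (nhds 0) := by
  obtain ⟨K, hK, hbound⟩ := exists_norm_momentRemainder_le hγ hf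
  rw [← integral_zero (Rn n) ℝ]
  refine tendsto_integral_filter_of_dominated_convergence
    (fun ξ => K ^ 2 * (‖ξ‖ ^ (2 * γ) * Real.exp (-(2 * c) * ‖ξ‖ ^ 2))) (.of_forall fun r => ?_) ?_
    ((integrable_norm_rpow_mul_exp_neg_mul_sq hn (by positivity) (by positivity)).const_mul _)
    (.of_forall fun ξ => ?_)
  · have hcont := continuous_momentRemainder hf.1 ⌊γ⌋₊
    have : Continuous fun ξ : Rn n => Real.exp (-(2 * c) * ‖ξ‖ ^ 2) *
        ‖((r ^ γ : ℝ) : ℂ) * momentRemainder n f ⌊γ⌋₊ (r⁻¹ • ξ)‖ ^ 2 := by fun_prop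
    exact this.aestronglyMeasurable
  · filter_upwards [eventually_gt_atTop 0] with r hr
    refine .of_forall fun ξ => ?_
    rw [Real.norm_of_nonneg (by positivity), norm_mul, Complex.norm_real,
      Real.norm_of_nonneg (by positivity)]
    calc _ ≤ Real.exp (-(2 * c) * ‖ξ‖ ^ 2) * (r ^ γ * (K * ‖r⁻¹ • ξ‖ ^ γ)) ^ 2 := by
          gcongr
          exact hbound _
      _ = K ^ 2 * ((r ^ γ * ‖r⁻¹ • ξ‖ ^ γ) ^ 2 * Real.exp (-(2 * c) * ‖ξ‖ ^ 2)) := by ring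
      _ = _ := by
          rw [norm_inv_smul_rpow hr, mul_comm 2 γ, Real.rpow_mul (norm_nonneg _), Real.rpow_two]
  · have h := ((tendsto_rpow_mul_momentRemainder hγ hf ξ).norm.pow 2).const_mul
      (Real.exp (-(2 * c) * ‖ξ‖ ^ 2))
    rwa [norm_zero, zero_pow two_ne_zero, mul_zero] at h

lemma rpow_mul_sqrt_integral_eq {n : ℕ} {γ c t : ℝ} (ht : 0 < t) (g : Rn n → ℂ) :
    t ^ ((n : ℝ) / 4 + γ / 2) *
      √(∫ ξ : Rn n, Real.exp (-(2 * c) * t * ‖ξ‖ ^ 2) * ‖g ξ‖ ^ 2) =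
    √(∫ ξ : Rn n, Real.exp (-(2 * c) * ‖ξ‖ ^ 2) *
      ‖(((√t) ^ γ : ℝ) : ℂ) * g ((√t)⁻¹ • ξ)‖ ^ 2) := by
  have hr : 0 < √t := Real.sqrt_pos.mpr ht
  have hscale := Measure.integral_comp_smul volume
    (fun ξ : Rn n => Real.exp (-(2 * c) * t * ‖ξ‖ ^ 2) * ‖g ξ‖ ^ 2) (√t)⁻¹
  rw [finrank_euclideanSpace_fin, abs_of_pos (by positivity), inv_pow, inv_inv,
    smul_eq_mul] at hscale
  have hcongr : ∀ ξ : Rn n, Real.exp (-(2 * c) * ‖ξ‖ ^ 2) *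
      ‖(((√t) ^ γ : ℝ) : ℂ) * g ((√t)⁻¹ • ξ)‖ ^ 2 =
      ((√t) ^ γ) ^ 2 * (Real.exp (-(2 * c) * t * ‖(√t)⁻¹ • ξ‖ ^ 2) *
        ‖g ((√t)⁻¹ • ξ)‖ ^ 2) := fun ξ => by
    have h : t * ‖(√t)⁻¹ • ξ‖ ^ 2 = ‖ξ‖ ^ 2 := by
      rw [norm_smul, Real.norm_of_nonneg (by positivity), mul_pow, inv_pow, Real.sq_sqrt ht.le,
        mul_inv_cancel_left₀ ht.ne']
    rw [mul_assoc (-(2 * c)), h, norm_mul, Complex.norm_real, Real.norm_of_nonneg (by positivity)]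
    ring
  simp_rw [hcongr]
  rw [integral_const_mul, hscale, ← mul_assoc, Real.sqrt_mul (by positivity)]
  congr 1
  rw [eq_comm, Real.sqrt_eq_iff_mul_self_eq (by positivity) (by positivity), ← Real.rpow_add ht,
    ← Real.rpow_natCast, ← Real.rpow_natCast, Real.sqrt_eq_rpow, ← Real.rpow_mul ht.le,
    ← Real.rpow_mul ht.le, ← Real.rpow_mul ht.le, ← Real.rpow_add ht]
  congr 1
  push_cast
  ring

theorem stmt12 (n : ℕ) (hn : 1 ≤ n) (γ : ℝ) (hγ : 0 ≤ γ) (c : ℝ) (hc : 0 < c)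
    (f : Rn n → ℝ) (hf : MemL1w n γ f) :
    Tendsto (fun t : ℝ => t ^ ((n : ℝ) / 4 + γ / 2) *
      Real.sqrt (∫ ξ : Rn n,
        ‖((Real.exp (-(c * t * ‖ξ‖ ^ 2)) : ℝ) : ℂ) * fourierHat n f ξ -
          ∑ k ∈ Finset.range (⌊γ⌋₊ + 1),
            mom n f k ξ * ((Real.exp (-(c * t * ‖ξ‖ ^ 2)) : ℝ) : ℂ)‖ ^ 2))
      atTop (nhds 0) := by
  have h := (tendsto_integral_exp_mul_momentRemainder hn hγ hc hf).comp Real.tendsto_sqrt_atTop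
  have h' := (Real.continuous_sqrt.tendsto 0).comp h
  rw [Real.sqrt_zero] at h'
  refine h'.congr' ?_
  filter_upwards [eventually_gt_atTop 0] with t ht
  simp only [Function.comp_apply]
  rw [← rpow_mul_sqrt_integral_eq ht]
  congr 3
  funext ξ
  rw [← Finset.sum_mul, mul_comm _ (fourierHat n f ξ), ← sub_mul, norm_mul, mul_pow,
    Complex.norm_real, Real.norm_of_nonneg (Real.exp_pos _).le, ← Real.exp_nat_mul, mul_comm]
  unfold momentRemainder
  congr 2
  push_cast
  ring
end
end

section
/- Let n ≥ 1 and γ ≥ 0. Then there exists T > 0 such that for all t ≥ T: ∫_{|ξ|≤1} |ξ|^{2γ} e^{−t|ξ|²} | cos(t|ξ|) |² dξ ≥ (ω_n/4) ( ∫_0^1 x^{2γ+n−1} e^{−x²} dx ) t^{−n/2−γ}, where ω_n = 2π^{n/2}/Γ(n/2) is the surface area of the unit sphere in ℝⁿ. -/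
open MeasureTheory Filter

noncomputable section

lemma tendsto_integral_mul_cos_atTop {g : ℝ → ℝ} (hg : Integrable g) :
    Tendsto (fun s : ℝ => ∫ x, g x * Real.cos (2 * s * x)) atTop (nhds 0) := by
  have h := (Real.tendsto_integral_exp_smul_cocompact (fun x => (g x : ℂ))).comp
    ((tendsto_id.atTop_div_const Real.pi_pos).mono_right atTop_le_cocompact)
  refine ((Complex.continuous_re.tendsto 0).comp h).congr fun s => ?_
  have hint : Integrable (fun x : ℝ => Real.fourierChar (-(x * (s / Real.pi))) • (g x : ℂ)) := by
    have := (Real.fourierIntegral_convergent_iff (V := ℝ) (μ := volume)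
      (f := fun x => (g x : ℂ)) (s / Real.pi)).2 hg.ofReal
    simpa [mul_comm] using this
  have hre := integral_re hint
  simp only [Function.comp_apply, id_eq]
  rw [← RCLike.re_eq_complex_re, ← hre]
  congr 1 with x
  have harg : 2 * Real.pi * -(x * (s / Real.pi)) = -(2 * s * x) := by
    field_simp
  rw [Circle.smul_def, Real.fourierChar_apply, harg, smul_eq_mul, RCLike.re_eq_complex_re,
    Complex.re_mul_ofReal, Complex.exp_ofReal_mul_I_re, Real.cos_neg, mul_comm]

/-- The integrals of `g x * cos (s * x) ^ 2` tend to half the integral of `g`, so they eventually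
exceed a quarter of it. -/
lemma eventually_quarter_integral_le_integral_mul_cos_sq {g : ℝ → ℝ}
    (hg : IntervalIntegrable g volume 0 1) (hpos : 0 < ∫ x in (0 : ℝ)..1, g x) :
    ∀ᶠ s : ℝ in atTop, (∫ x in (0 : ℝ)..1, g x) / 4 ≤
      ∫ x in (0 : ℝ)..1, g x * Real.cos (s * x) ^ 2 := by
  have hg' : IntegrableOn g (Set.Ioc 0 1) :=
    (intervalIntegrable_iff_integrableOn_Ioc_of_le zero_le_one).1 hg
  have h := tendsto_integral_mul_cos_atTop (hg'.integrable_indicator measurableSet_Ioc)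
  have hev := h.eventually (lt_mem_nhds (show -((∫ x in (0 : ℝ)..1, g x) / 2) < 0 by linarith))
  filter_upwards [hev] with s hs
  have e1 : ∫ x, (Set.Ioc (0 : ℝ) 1).indicator g x * Real.cos (2 * s * x) =
      ∫ x in (0 : ℝ)..1, g x * Real.cos (2 * s * x) := by
    rw [intervalIntegral.integral_of_le zero_le_one, ← integral_indicator measurableSet_Ioc]
    exact integral_congr_ae (.of_forall fun x => by
      by_cases hx : x ∈ Set.Ioc (0 : ℝ) 1 <;> simp [hx])
  have hc : IntervalIntegrable (fun x => g x * Real.cos (2 * s * x)) volume 0 1 :=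
    hg.mul_continuousOn (by fun_prop)
  have e2 : ∫ x in (0 : ℝ)..1, g x * Real.cos (s * x) ^ 2 =
      ((∫ x in (0 : ℝ)..1, g x) + ∫ x in (0 : ℝ)..1, g x * Real.cos (2 * s * x)) / 2 := by
    rw [← intervalIntegral.integral_add hg hc, ← intervalIntegral.integral_div]
    congr 1 with x
    rw [Real.cos_sq, mul_assoc 2 s x]
    ring
  rw [e1] at hs
  rw [e2]
  linarith

lemma setIntegral_closedBall_fun_norm {n : ℕ} (hn : 1 ≤ n) (f : ℝ → ℝ) :
    ∫ ξ in Metric.closedBall (0 : Rn n) 1, f ‖ξ‖ =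
      2 * Real.pi ^ ((n : ℝ) / 2) / Real.Gamma ((n : ℝ) / 2) *
        ∫ y in (0 : ℝ)..1, y ^ (n - 1) * f y := by
  have : Nonempty (Fin n) := ⟨⟨0, hn⟩⟩
  have hn0 : (0 : ℝ) < n := by exact_mod_cast hn
  have h := integral_fun_norm_addHaar (volume : Measure (Rn n)) ((Set.Iic (1 : ℝ)).indicator f)
  have e1 : ∫ ξ in Metric.closedBall (0 : Rn n) 1, f ‖ξ‖ =
      ∫ ξ : Rn n, (Set.Iic (1 : ℝ)).indicator f ‖ξ‖ := by
    rw [← integral_indicator Metric.isClosed_closedBall.measurableSet]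
    congr 1 with ξ
    simp [Set.indicator]
  have e2 : ∫ y in Set.Ioi (0 : ℝ), y ^ (n - 1) • (Set.Iic (1 : ℝ)).indicator f y =
      ∫ y in (0 : ℝ)..1, y ^ (n - 1) * f y := by
    rw [intervalIntegral.integral_of_le zero_le_one, ← Set.Ioi_inter_Iic,
      ← setIntegral_indicator measurableSet_Iic]
    congr 1 with y
    by_cases hy : y ∈ Set.Iic (1 : ℝ) <;> simp [hy]
  have hvol : (n : ℝ) * volume.real (Metric.ball (0 : Rn n) 1) =
      2 * Real.pi ^ ((n : ℝ) / 2) / Real.Gamma ((n : ℝ) / 2) := by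
    rw [Measure.real, EuclideanSpace.volume_ball, Fintype.card_fin, ENNReal.ofReal_one, one_pow,
      one_mul, ENNReal.toReal_ofReal (by positivity), Real.Gamma_add_one (by positivity),
      Real.sqrt_eq_rpow, ← Real.rpow_mul_natCast Real.pi_pos.le]
    have : Real.Gamma ((n : ℝ) / 2) ≠ 0 := (Real.Gamma_pos_of_pos (by positivity)).ne'
    field_simp
  rw [e1, h, finrank_euclideanSpace_fin, e2, ← hvol]
  simp [mul_assoc]

lemma integral_rpow_mul_exp_mul_cos_sq_rescale (a : ℝ) {s : ℝ} (hs : 0 < s) :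
    ∫ y in (0 : ℝ)..s⁻¹, y ^ a * Real.exp (-(s ^ 2 * y ^ 2)) * Real.cos (s ^ 2 * y) ^ 2 =
      s ^ (-(a + 1)) *
        ∫ x in (0 : ℝ)..1, x ^ a * Real.exp (-x ^ 2) * Real.cos (s * x) ^ 2 := by
  have h := intervalIntegral.integral_comp_mul_left (a := 0) (b := 1)
    (fun y : ℝ => y ^ a * Real.exp (-(s ^ 2 * y ^ 2)) * Real.cos (s ^ 2 * y) ^ 2)
    (inv_ne_zero hs.ne')
  rw [mul_zero, mul_one, inv_inv, smul_eq_mul] at h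
  have h2 : ∫ x in (0 : ℝ)..1, (s⁻¹ * x) ^ a * Real.exp (-(s ^ 2 * (s⁻¹ * x) ^ 2)) *
      Real.cos (s ^ 2 * (s⁻¹ * x)) ^ 2 =
      s ^ (-a) * ∫ x in (0 : ℝ)..1, x ^ a * Real.exp (-x ^ 2) * Real.cos (s * x) ^ 2 := by
    rw [← intervalIntegral.integral_const_mul]
    refine intervalIntegral.integral_congr fun x hx => ?_
    rw [Set.uIcc_of_le zero_le_one] at hx
    have e1 : s ^ 2 * (s⁻¹ * x) ^ 2 = x ^ 2 := by field_simp
    have e2 : s ^ 2 * (s⁻¹ * x) = s * x := by field_simp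
    simp only [e1, e2]
    rw [Real.mul_rpow (by positivity) hx.1, Real.inv_rpow hs.le, Real.rpow_neg hs.le]
    ring
  rw [h2] at h
  rw [show -(a + 1) = -a - 1 by ring, Real.rpow_sub_one hs.ne', div_mul_eq_mul_div, h]
  field_simp

theorem stmt14 (n : ℕ) (hn : 1 ≤ n) (γ : ℝ) (hγ : 0 ≤ γ) :
    ∃ T : ℝ, 0 < T ∧ ∀ t : ℝ, T ≤ t →
      2 * Real.pi ^ ((n : ℝ) / 2) / Real.Gamma ((n : ℝ) / 2) / 4 *
          (∫ x in (0 : ℝ)..1, x ^ (2 * γ + (n : ℝ) - 1) * Real.exp (-x ^ 2)) *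
          t ^ (-(n : ℝ) / 2 - γ) ≤
        ∫ ξ in Metric.closedBall (0 : Rn n) 1,
          ‖ξ‖ ^ (2 * γ) * Real.exp (-(t * ‖ξ‖ ^ 2)) * (Real.cos (t * ‖ξ‖)) ^ 2 := by
  have hn' : (1 : ℝ) ≤ n := by exact_mod_cast hn
  set a : ℝ := 2 * γ + n - 1 with ha
  have ha0 : 0 ≤ a := by linarith
  have hcont : Continuous fun x : ℝ => x ^ a * Real.exp (-x ^ 2) :=
    (Real.continuous_rpow_const ha0).mul (by fun_prop)
  have hpos : 0 < ∫ x in (0 : ℝ)..1, x ^ a * Real.exp (-x ^ 2) :=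
    intervalIntegral.intervalIntegral_pos_of_pos_on (hcont.intervalIntegrable _ _)
      (fun x hx => mul_pos (Real.rpow_pos_of_pos hx.1 a) (Real.exp_pos _)) zero_lt_one
  obtain ⟨S, hS⟩ := eventually_atTop.1
    (eventually_quarter_integral_le_integral_mul_cos_sq (hcont.intervalIntegrable 0 1) hpos)
  refine ⟨max 1 (S ^ 2), by positivity, fun t ht => ?_⟩
  have ht1 : 1 ≤ t := (le_max_left _ _).trans ht
  obtain ⟨s, hs1, hst⟩ : ∃ s : ℝ, 1 ≤ s ∧ s ^ 2 = t :=
    ⟨√t, Real.one_le_sqrt.2 ht1, Real.sq_sqrt (by linarith)⟩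
  have hs0 : 0 < s := by linarith
  have hSs : S ≤ s := le_of_sq_le_sq (by rw [hst]; exact (le_max_right _ _).trans ht) hs0.le
  have hrpow : t ^ (-(n : ℝ) / 2 - γ) = s ^ (-(a + 1)) := by
    rw [← hst, ← Real.rpow_natCast_mul hs0.le]
    congr 1
    push_cast
    rw [ha]
    ring
  have hpolar : ∫ y in (0 : ℝ)..1, y ^ (n - 1) *
        (y ^ (2 * γ) * Real.exp (-(t * y ^ 2)) * Real.cos (t * y) ^ 2) =
      ∫ y in (0 : ℝ)..1, y ^ a * Real.exp (-(t * y ^ 2)) * Real.cos (t * y) ^ 2 := by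
    refine intervalIntegral.integral_congr fun y hy => ?_
    rw [Set.uIcc_of_le zero_le_one] at hy
    have hexp : y ^ a = y ^ (n - 1) * y ^ (2 * γ) := by
      rw [← Real.rpow_natCast, ← Real.rpow_add_of_nonneg hy.1 (by positivity) (by positivity),
        Nat.cast_sub hn, ha]
      congr 1
      push_cast
      ring
    simp only [hexp]
    ring
  have hcont' : Continuous fun y : ℝ =>
      y ^ a * Real.exp (-(t * y ^ 2)) * Real.cos (t * y) ^ 2 :=
    ((Real.continuous_rpow_const ha0).mul (by fun_prop)).mul (by fun_prop)
  have hmono : ∫ y in (0 : ℝ)..s⁻¹, y ^ a * Real.exp (-(t * y ^ 2)) * Real.cos (t * y) ^ 2 ≤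
      ∫ y in (0 : ℝ)..1, y ^ a * Real.exp (-(t * y ^ 2)) * Real.cos (t * y) ^ 2 := by
    refine intervalIntegral.integral_mono_interval le_rfl (by positivity)
      (inv_le_one_of_one_le₀ hs1) ?_ (hcont'.intervalIntegrable _ _)
    filter_upwards [ae_restrict_mem measurableSet_Ioc] with y hy
    have := Real.rpow_nonneg hy.1.le a
    simp only [Pi.zero_apply]
    positivity
  have hscale := integral_rpow_mul_exp_mul_cos_sq_rescale a hs0
  rw [hst] at hscale
  have hω : 0 ≤ 2 * Real.pi ^ ((n : ℝ) / 2) / Real.Gamma ((n : ℝ) / 2) := by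
    have := Real.Gamma_pos_of_pos (show 0 < (n : ℝ) / 2 by linarith)
    positivity
  rw [setIntegral_closedBall_fun_norm hn
    (fun y => y ^ (2 * γ) * Real.exp (-(t * y ^ 2)) * Real.cos (t * y) ^ 2), hpolar, hrpow]
  rw [div_mul_eq_mul_div, mul_div_assoc, mul_assoc]
  refine mul_le_mul_of_nonneg_left ?_ hω
  refine le_trans ?_ (hscale.ge.trans hmono)
  rw [mul_comm]
  exact mul_le_mul_of_nonneg_left (hS s hSs) (by positivity)
end
end
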